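/- In ℚ[x,y,z], let F = σ₂² − 4σ₁σ₃, Q = 27σ₂ − 8σ₁², T = 729σ₃ − 108σ₁σ₂ + 16σ₁³. Perform in the nine polynomials below the substitution s ↦ Q/2, u ↦ T, y ↦ T·y, z ↦ T·z, v ↦ T(y−z)(5x−4y−4z), w ↦ T(8x−y−z)(5x−4y−4z) (where on the right x, y, z denote the coordinates of ℚ[x,y,z]). Then each of the six 2×2 minors of the matrix with rows (u, y−z, 8s²−9y−9z, w) and (5s²−9y−9z, v, w, u²−46s³+54ys+54zs), and each of the three polynomials 8u²s + (8s²−9y−9z)(4s²−9y−9z) + 27(y−z)², 8(5s²−9y−9z)us + w(4s²−9y−9z) + 27(y−z)v, and 8(5s²−9y−9z)²s + (u²−46s³+54ys+54zs)(4s²−9y−9z) + 27v², becomes, after substitution, an element of the principal ideal of ℚ[x,y,z] generated by F. (These are the nine equations of the ring ⊕ₙ H⁰(C,nL) for the fourfold cover of the cone over the three-cuspidal quartic.) -/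

import Mathlib

open MvPolynomial

namespace Stmt7

noncomputable section

def x : MvPolynomial (Fin 3) ℚ := X 0
def y : MvPolynomial (Fin 3) ℚ := X 1
def z : MvPolynomial (Fin 3) ℚ := X 2

def σ₁ : MvPolynomial (Fin 3) ℚ := x + y + z
def σ₂ : MvPolynomial (Fin 3) ℚ := x * y + y * z + z * x
def σ₃ : MvPolynomial (Fin 3) ℚ := x * y * z

/-- The equation of the three-cuspidal rational quartic. -/
def F : MvPolynomial (Fin 3) ℚ := σ₂ ^ 2 - 4 * σ₁ * σ₃

/-- The contact conic. -/
def Q : MvPolynomial (Fin 3) ℚ := 27 * σ₂ - 8 * σ₁ ^ 2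

/-- The contact cubic. -/
def T : MvPolynomial (Fin 3) ℚ := 729 * σ₃ - 108 * σ₁ * σ₂ + 16 * σ₁ ^ 3

/-- The substituted values of the six generators `s, u, y, z, v, w` of the fourfold
cover ring: `s ↦ Q/2`, `u ↦ T`, `y ↦ Ty`, `z ↦ Tz`, `v ↦ T(y−z)(5x−4y−4z)`,
`w ↦ T(8x−y−z)(5x−4y−4z)`. -/
def sv : MvPolynomial (Fin 3) ℚ := C (1 / 2 : ℚ) * Q
def uv : MvPolynomial (Fin 3) ℚ := T
def yv : MvPolynomial (Fin 3) ℚ := T * y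
def zv : MvPolynomial (Fin 3) ℚ := T * z
def vv : MvPolynomial (Fin 3) ℚ := T * (y - z) * (5 * x - 4 * y - 4 * z)
def wv : MvPolynomial (Fin 3) ℚ := T * (8 * x - y - z) * (5 * x - 4 * y - 4 * z)

/-- Top row of the rolling factors matrix, after substitution. -/
def r₁ : Fin 4 → MvPolynomial (Fin 3) ℚ :=
  ![uv, yv - zv, 8 * sv ^ 2 - 9 * yv - 9 * zv, wv]

/-- Bottom row of the rolling factors matrix, after substitution. -/
def r₂ : Fin 4 → MvPolynomial (Fin 3) ℚ :=
  ![5 * sv ^ 2 - 9 * yv - 9 * zv, vv, wv,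
    uv ^ 2 - 46 * sv ^ 3 + 54 * yv * sv + 54 * zv * sv]

section HalvedCoordinates

variable {R : Type*} [CommRing R] (a b c : R)

/-- The equation `F` of the quartic at the point `(2a, 2b, 2c)`. -/
def doubledF : R :=
  16 * ((a * b + b * c + c * a) ^ 2 - 4 * (a + b + c) * (a * b * c))

/-- The generator `s = Q / 2` at the point `(2a, 2b, 2c)`, which is integral in `a, b, c`. -/
def doubledS : R :=
  2 * (27 * (a * b + b * c + c * a) - 8 * (a + b + c) ^ 2)

/-- The contact cubic `T` at the point `(a, b, c)`. -/
def cubic : R :=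
  729 * (a * b * c) - 108 * (a + b + c) * (a * b + b * c + c * a) + 16 * (a + b + c) ^ 3

/-- Top row of the rolling factors matrix at the point `(2a, 2b, 2c)`. -/
def topRow : Fin 4 → R :=
  ![8 * cubic a b c,
    16 * cubic a b c * (b - c),
    8 * doubledS a b c ^ 2 - 144 * cubic a b c * (b + c),
    32 * cubic a b c * (8 * a - b - c) * (5 * a - 4 * b - 4 * c)]

/-- Bottom row of the rolling factors matrix at the point `(2a, 2b, 2c)`. -/
def bottomRow : Fin 4 → R :=
  ![5 * doubledS a b c ^ 2 - 144 * cubic a b c * (b + c),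
    32 * cubic a b c * (b - c) * (5 * a - 4 * b - 4 * c),
    32 * cubic a b c * (8 * a - b - c) * (5 * a - 4 * b - 4 * c),
    64 * cubic a b c ^ 2 - 46 * doubledS a b c ^ 3
      + 864 * cubic a b c * (b + c) * doubledS a b c]

lemma doubledF_dvd_minor_zero_one :
    doubledF a b c ∣ topRow a b c 0 * bottomRow a b c 1 - topRow a b c 1 * bottomRow a b c 0 := by
  use cubic a b c * (b - c) * (-14580)
  simp only [topRow, bottomRow, Matrix.cons_val, doubledF, doubledS, cubic]
  ring

lemma doubledF_dvd_minor_zero_two :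
    doubledF a b c ∣ topRow a b c 0 * bottomRow a b c 2 - topRow a b c 2 * bottomRow a b c 0 := by
  use -3732480 * a ^ 4 + 15723072 * a ^ 3 * (b + c) - 13734360 * a ^ 2 * (b + c) ^ 2
      - 59836320 * a ^ 2 * (b * c) - 10206000 * a * (b + c) ^ 3
      + 134710452 * a * (b + c) * (b * c) + 1726272 * (b + c) ^ 4
      - 11652336 * (b + c) ^ 2 * (b * c) - 21257640 * (b * c) ^ 2
  simp only [topRow, bottomRow, Matrix.cons_val, doubledF, doubledS, cubic]
  ring

lemma doubledF_dvd_minor_zero_three :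
    doubledF a b c ∣ topRow a b c 0 * bottomRow a b c 3 - topRow a b c 3 * bottomRow a b c 0 := by
  use cubic a b c * (-93312 * a ^ 2 - 396576 * a * (b + c) + 956448 * (b + c) ^ 2
      - 3621672 * (b * c))
  simp only [topRow, bottomRow, Matrix.cons_val, doubledF, doubledS, cubic]
  ring

lemma doubledF_dvd_minor_one_two :
    doubledF a b c ∣ topRow a b c 1 * bottomRow a b c 2 - topRow a b c 2 * bottomRow a b c 1 := by
  use cubic a b c * (b - c) * (-233280 * a + 186624 * (b + c))
  simp only [topRow, bottomRow, Matrix.cons_val, doubledF, doubledS, cubic]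
  ring

lemma doubledF_dvd_minor_one_three :
    doubledF a b c ∣ topRow a b c 1 * bottomRow a b c 3 - topRow a b c 3 * bottomRow a b c 1 := by
  use cubic a b c * (b - c) * (2146176 * a ^ 2 - 2950992 * a * (b + c) + 2146176 * (b + c) ^ 2
      - 7243344 * (b * c))
  simp only [topRow, bottomRow, Matrix.cons_val, doubledF, doubledS, cubic]
  ring

lemma doubledF_dvd_minor_two_three :
    doubledF a b c ∣ topRow a b c 2 * bottomRow a b c 3 - topRow a b c 3 * bottomRow a b c 2 := by
  use 573308928 * a ^ 6 - 3077056512 * a ^ 5 * (b + c) + 5028770304 * a ^ 4 * (b + c) ^ 2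
      + 8807906304 * a ^ 4 * (b * c) - 2458467936 * a ^ 3 * (b + c) ^ 3
      - 25310133504 * a ^ 3 * (b + c) * (b * c) + 272517696 * a ^ 2 * (b + c) ^ 4
      + 17058075120 * a ^ 2 * (b + c) ^ 2 * (b * c) + 9387373824 * a ^ 2 * (b * c) ^ 2
      + 791099136 * a * (b + c) ^ 5 - 13745977344 * a * (b + c) ^ 3 * (b * c)
      + 27575410608 * a * (b + c) * (b * c) ^ 2 - 58226688 * (b + c) ^ 6
      + 508923648 * (b + c) ^ 4 * (b * c) + 2346843456 * (b + c) ^ 2 * (b * c) ^ 2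
      - 10560795552 * (b * c) ^ 3
  simp only [topRow, bottomRow, Matrix.cons_val, doubledF, doubledS, cubic]
  ring

lemma doubledF_dvd_minor (i j : Fin 4) :
    doubledF a b c ∣ topRow a b c i * bottomRow a b c j - topRow a b c j * bottomRow a b c i := by
  wlog h : i < j generalizing i j
  · rcases (not_lt.mp h).eq_or_lt with rfl | h
    · simp
    · rw [dvd_sub_comm]
      exact this j i h
  fin_cases i <;> fin_cases j <;> first
    | exact absurd h (by decide)
    | exact doubledF_dvd_minor_zero_one a b c
    | exact doubledF_dvd_minor_zero_two a b c
    | exact doubledF_dvd_minor_zero_three a b c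
    | exact doubledF_dvd_minor_one_two a b c
    | exact doubledF_dvd_minor_one_three a b c
    | exact doubledF_dvd_minor_two_three a b c

lemma doubledF_dvd_rolling_top_top :
    doubledF a b c ∣ 8 * topRow a b c 0 ^ 2 * doubledS a b c
      + topRow a b c 2 * (4 * doubledS a b c ^ 2 - 144 * cubic a b c * (b + c))
      + 27 * topRow a b c 1 ^ 2 := by
  use 2985984 * a ^ 4 - 13250304 * a ^ 3 * (b + c) + 13506912 * a ^ 2 * (b + c) ^ 2
      + 47869056 * a ^ 2 * (b * c) + 10684224 * a * (b + c) ^ 3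
      - 133844400 * a * (b + c) * (b * c) - 2052864 * (b + c) ^ 4
      + 13856832 * (b + c) ^ 2 * (b * c) + 17006112 * (b * c) ^ 2
  simp only [topRow, Matrix.cons_val, doubledF, doubledS, cubic]
  ring

lemma doubledF_dvd_rolling_top_bottom :
    doubledF a b c ∣ 8 * (bottomRow a b c 0 * topRow a b c 0) * doubledS a b c
      + topRow a b c 3 * (4 * doubledS a b c ^ 2 - 144 * cubic a b c * (b + c))
      + 27 * (topRow a b c 1 * bottomRow a b c 1) := by
  use cubic a b c * (419904 * a * (b + c) - 839808 * (b + c) ^ 2 + 3149280 * (b * c))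
  simp only [topRow, bottomRow, Matrix.cons_val, doubledF, doubledS, cubic]
  ring

lemma doubledF_dvd_rolling_bottom_bottom :
    doubledF a b c ∣ 8 * bottomRow a b c 0 ^ 2 * doubledS a b c
      + bottomRow a b c 3 * (4 * doubledS a b c ^ 2 - 144 * cubic a b c * (b + c))
      + 27 * bottomRow a b c 1 ^ 2 := by
  use -11943936 * a ^ 6 + 76142592 * a ^ 5 * (b + c) - 337042944 * a ^ 4 * (b + c) ^ 2
      + 624817152 * a ^ 4 * (b * c) + 593580960 * a ^ 3 * (b + c) ^ 3
      - 1446149376 * a ^ 3 * (b + c) * (b * c) + 168941376 * a ^ 2 * (b + c) ^ 4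
      - 5749010640 * a ^ 2 * (b + c) ^ 2 * (b * c) + 19148882112 * a ^ 2 * (b * c) ^ 2
      - 335363328 * a * (b + c) ^ 5 + 4676050944 * a * (b + c) ^ 3 * (b * c)
      - 13205245968 * a * (b + c) * (b * c) ^ 2 + 55240704 * (b + c) ^ 6
      - 599622912 * (b + c) ^ 4 * (b * c) + 1394501184 * (b + c) ^ 2 * (b * c) ^ 2
      + 459165024 * (b * c) ^ 3
  simp only [bottomRow, Matrix.cons_val, doubledF, doubledS, cubic]
  ring

end HalvedCoordinates

lemma exists_eq_two_mul (p : MvPolynomial (Fin 3) ℚ) : ∃ q, p = 2 * q :=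
  ⟨C (1 / 2) * p, by rw [← mul_assoc, two_mul, ← C_add]; norm_num⟩

/-- After substitution, each of the six 2×2 minors of the rolling factors matrix and
each of the three additional rolling factors polynomials lies in the principal ideal
generated by `F`. -/
theorem stmt7 :
    (∀ i j : Fin 4, r₁ i * r₂ j - r₁ j * r₂ i ∈ Ideal.span {F}) ∧
    8 * uv ^ 2 * sv + (8 * sv ^ 2 - 9 * yv - 9 * zv) * (4 * sv ^ 2 - 9 * yv - 9 * zv)
        + 27 * (yv - zv) ^ 2 ∈ Ideal.span {F} ∧
    8 * (5 * sv ^ 2 - 9 * yv - 9 * zv) * uv * sv + wv * (4 * sv ^ 2 - 9 * yv - 9 * zv)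
        + 27 * (yv - zv) * vv ∈ Ideal.span {F} ∧
    8 * (5 * sv ^ 2 - 9 * yv - 9 * zv) ^ 2 * sv
        + (uv ^ 2 - 46 * sv ^ 3 + 54 * yv * sv + 54 * zv * sv)
            * (4 * sv ^ 2 - 9 * yv - 9 * zv)
        + 27 * vv ^ 2 ∈ Ideal.span {F} := by
  obtain ⟨a, ha⟩ := exists_eq_two_mul x
  obtain ⟨b, hb⟩ := exists_eq_two_mul y
  obtain ⟨c, hc⟩ := exists_eq_two_mul z
  have hF : F = doubledF a b c := by
    simp only [F, σ₁, σ₂, σ₃, ha, hb, hc, doubledF]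
    ring
  have hT : T = 8 * cubic a b c := by
    simp only [T, σ₁, σ₂, σ₃, ha, hb, hc, cubic]
    ring
  have hs : sv = doubledS a b c := by
    have half : (C (1 / 2 : ℚ) : MvPolynomial (Fin 3) ℚ) * 2 = 1 := by
      rw [mul_two, ← C_add]
      norm_num
    simp only [sv, Q, σ₁, σ₂, ha, hb, hc, doubledS]
    linear_combination (2 * (27 * (a * b + b * c + c * a) - 8 * (a + b + c) ^ 2)) * half
  have h₁ : r₁ = topRow a b c := by
    simp only [r₁, topRow, uv, yv, zv, wv, hs, hT, ha, hb, hc]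
    ring_nf
  have h₂ : r₂ = bottomRow a b c := by
    simp only [r₂, bottomRow, uv, yv, zv, vv, wv, hs, hT, ha, hb, hc]
    ring_nf
  have hL : 4 * sv ^ 2 - 9 * yv - 9 * zv
      = 4 * doubledS a b c ^ 2 - 144 * cubic a b c * (b + c) := by
    simp only [yv, zv, hs, hT, hb, hc]
    ring
  simp only [Ideal.mem_span_singleton]
  rw [hL, hF]
  refine ⟨?_, ?_, ?_, ?_⟩
  · rw [h₁, h₂]
    exact doubledF_dvd_minor a b c
  · simpa only [← h₁, ← h₂, ← hs, r₁, r₂, Matrix.cons_val, ← mul_assoc]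
      using doubledF_dvd_rolling_top_top a b c
  · simpa only [← h₁, ← h₂, ← hs, r₁, r₂, Matrix.cons_val, ← mul_assoc]
      using doubledF_dvd_rolling_top_bottom a b c
  · simpa only [← h₁, ← h₂, ← hs, r₁, r₂, Matrix.cons_val, ← mul_assoc]
      using doubledF_dvd_rolling_bottom_bottom a b c

end

end Stmt7
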